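/- Let w = w_1^{c_1}⋯w_n^{c_n} ∈ Z_α ≀ S_n have last color 0, and suppose there exists an index i with c_i = c_{i+1} and w_i > w_{i+1}. Let w' ∈ Z_α ≀ S_{n−1} be obtained by deleting w_i^{c_i} and relabeling the remaining values order-isomorphically. Then flag(w') = flag(w) − α, and moreover flag(r(w')) = flag(r(w)) or flag(r(w')) = flag(r(w)) − α, with exactly one of the two reductions by α occurring between the pair (w, r(w)) and (w', r(w')); in total flag(w) + flag(r(w)) = flag(w') + flag(r(w')) + α. -/

import Mathlib

open Finset Polynomial

/-- The `i`-th position (0-indexed) among the first `n-1` positions, as an element of `Fin n`. -/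
def lo (n : ℕ) (i : Fin (n - 1)) : Fin n := ⟨i.val, by have := i.isLt; omega⟩

/-- The `(i+1)`-st position, as an element of `Fin n`. -/
def hi (n : ℕ) (i : Fin (n - 1)) : Fin n := ⟨i.val + 1, by have := i.isLt; omega⟩

/-- The colored descent number `d(w)` of a colored permutation, given by the underlying
permutation `w` and the color vector `c`. -/
def cdes {n α : ℕ} (w : Equiv.Perm (Fin n)) (c : Fin n → ZMod α) : ℕ :=
  (univ.filter (fun i : Fin (n - 1) =>
    c (lo n i) ≠ c (hi n i) ∨ (c (lo n i) = c (hi n i) ∧ w (hi n i) < w (lo n i)))).card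

/-- The flag descent statistic of a colored permutation. -/
def flagStat {n α : ℕ} (w : Equiv.Perm (Fin n)) (c : Fin n → ZMod α) : ℕ :=
  α * (univ.filter (fun i : Fin (n - 1) =>
        c (lo n i) = c (hi n i) ∧ w (hi n i) < w (lo n i))).card
  + α * (univ.filter (fun i : Fin (n - 1) =>
        (c (lo n i)).val < (c (hi n i)).val)).card
  + (if h : 0 < n then (c ⟨0, h⟩).val else 0)

/-- The classical descent number of a permutation. -/
def des {n : ℕ} (w : Equiv.Perm (Fin n)) : ℕ :=
  (univ.filter (fun i : Fin (n - 1) => w (hi n i) < w (lo n i))).card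

/-- The reversal of the underlying permutation (in one-line notation). -/
def rPerm {n : ℕ} (w : Equiv.Perm (Fin n)) : Equiv.Perm (Fin n) :=
  (Fin.revPerm : Equiv.Perm (Fin n)).trans w

/-- The reversed color vector with `c 0` subtracted from every color. -/
def rCol {n α : ℕ} (c : Fin n → ZMod α) : Fin n → ZMod α :=
  fun i => c i.rev - (if h : 0 < n then c ⟨0, h⟩ else 0)

/-- The position in the original word corresponding to position `j` after deleting
position `i₀`. -/
def oldPos (n : ℕ) (i₀ j : Fin (n - 1)) : Fin n :=
  if j.val < i₀.val then ⟨j.val, by have := j.isLt; omega⟩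
  else ⟨j.val + 1, by have := j.isLt; omega⟩

/-- Sum over consecutive pairs after deleting position `k`. -/
lemma sum_del_range (D : ℕ → ℕ → ℕ) (m k : ℕ) (hk : k ≤ m) :
    ∑ i ∈ range (m + 1), D i (i + 1) + (if k = 0 then 0 else D (k - 1) (k + 1))
    = ∑ j ∈ range m, D (if j < k then j else j + 1) (if j + 1 < k then j + 1 else j + 1 + 1)
      + (if k = 0 then 0 else D (k - 1) k) + D k (k + 1) := by
  induction m with
  | zero =>
    obtain rfl : k = 0 := by omega
    simp
  | succ m ih =>
    by_cases h : k ≤ m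
    · have := ih h
      rw [sum_range_succ, sum_range_succ (fun j => D (if j < k then j else j + 1) _)]
      rw [if_neg (show ¬ m < k by omega), if_neg (show ¬ m + 1 < k by omega)]
      omega
    · obtain rfl : k = m + 1 := by omega
      rw [sum_range_succ, sum_range_succ, sum_range_succ (n := m)]
      have : ∑ j ∈ range m, D (if j < m + 1 then j else j + 1)
          (if j + 1 < m + 1 then j + 1 else j + 1 + 1) = ∑ j ∈ range m, D j (j + 1) := by
        apply sum_congr rfl
        intro j hj
        have := mem_range.1 hj
        rw [if_pos (by omega), if_pos (by omega)]
      rw [this]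
      simp
      omega

lemma sum_del (m : ℕ) (F : Fin (m + 2) → Fin (m + 2) → ℕ) (k : Fin (m + 2 - 1)) :
    ∑ i : Fin (m + 2 - 1), F (lo (m + 2) i) (hi (m + 2) i)
      + (if h : k.val = 0 then 0 else F ⟨k.val - 1, by omega⟩ (hi (m + 2) k))
    = ∑ j : Fin (m + 2 - 1 - 1), F (oldPos (m + 2) k (lo (m + 2 - 1) j))
        (oldPos (m + 2) k (hi (m + 2 - 1) j))
      + (if h : k.val = 0 then 0 else F ⟨k.val - 1, by omega⟩ (lo (m + 2) k))
      + F (lo (m + 2) k) (hi (m + 2) k) := by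
  have hk := k.isLt
  have key := sum_del_range
    (fun a b => if h : a < m + 2 ∧ b < m + 2 then F ⟨a, h.1⟩ ⟨b, h.2⟩ else 0) m k.val (by omega)
  have e1 : ∑ i : Fin (m + 2 - 1), F (lo (m + 2) i) (hi (m + 2) i)
      = ∑ i ∈ range (m + 1), (fun a b => if h : a < m + 2 ∧ b < m + 2 then
          F ⟨a, h.1⟩ ⟨b, h.2⟩ else 0) i (i + 1) := by
    rw [← Fin.sum_univ_eq_sum_range (fun i => (fun a b => if h : a < m + 2 ∧ b < m + 2 then
          F ⟨a, h.1⟩ ⟨b, h.2⟩ else 0) i (i + 1)) (m + 1)]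
    apply Finset.sum_congr rfl
    intro i _
    have hi := i.isLt
    have h : i.val < m + 2 ∧ i.val + 1 < m + 2 := by omega
    refine Eq.trans ?_ (dif_pos h).symm
    rfl
  have e2 : ∑ j : Fin (m + 2 - 1 - 1), F (oldPos (m + 2) k (lo (m + 2 - 1) j))
        (oldPos (m + 2) k (hi (m + 2 - 1) j))
      = ∑ j ∈ range m, (fun a b => if h : a < m + 2 ∧ b < m + 2 then
          F ⟨a, h.1⟩ ⟨b, h.2⟩ else 0) (if j < k.val then j else j + 1)
            (if j + 1 < k.val then j + 1 else j + 1 + 1) := by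
    rw [← Fin.sum_univ_eq_sum_range (fun j => (fun a b => if h : a < m + 2 ∧ b < m + 2 then
          F ⟨a, h.1⟩ ⟨b, h.2⟩ else 0) (if j < k.val then j else j + 1)
            (if j + 1 < k.val then j + 1 else j + 1 + 1)) m]
    apply Finset.sum_congr rfl
    intro j _
    have hj := j.isLt
    have h : (if j.val < k.val then j.val else j.val + 1) < m + 2 ∧
      (if j.val + 1 < k.val then j.val + 1 else j.val + 1 + 1) < m + 2 := by
      constructor <;> split_ifs <;> omega
    refine Eq.trans ?_ (dif_pos h).symm
    congr 1
    · apply Fin.ext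
      simp only [oldPos, lo]
      split_ifs with h' <;> simp [h']
    · apply Fin.ext
      simp only [oldPos, hi]
      split_ifs with h' <;> simp [h']
  rw [e1, e2]
  have h1 : k.val < m + 2 := by omega
  have h2 : k.val - 1 < m + 2 := by omega
  have h3 : k.val + 1 < m + 2 := by omega
  by_cases h0 : k.val = 0
  · simpa [h0, lo, hi, h1, h2, h3] using key
  · simpa [h0, lo, hi, h1, h2, h3] using key

/-- Contribution of a pair of positions to the flag statistic. -/
def pairT {n α : ℕ} (w : Equiv.Perm (Fin n)) (c : Fin n → ZMod α) (p q : Fin n) : ℕ :=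
  (if c p = c q ∧ w q < w p then 1 else 0) + (if (c p).val < (c q).val then 1 else 0)

/-- Contribution of a pair of positions to the flag statistic of the reversal. -/
def pairR {n α : ℕ} (w : Equiv.Perm (Fin n)) (c : Fin n → ZMod α) (u : ZMod α)
    (p q : Fin n) : ℕ :=
  (if c p = c q ∧ w p < w q then 1 else 0) + (if (c q - u).val < (c p - u).val then 1 else 0)

lemma flag_eq {n α : ℕ} (hn : 0 < n) (w : Equiv.Perm (Fin n)) (c : Fin n → ZMod α) :
    flagStat w c = α * ∑ i : Fin (n - 1), pairT w c (lo n i) (hi n i) + (c ⟨0, hn⟩).val := by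
  simp only [flagStat, pairT, sum_add_distrib, card_filter, dif_pos hn, mul_add]

lemma flag_r_eq {n α : ℕ} (hn : 0 < n) (w : Equiv.Perm (Fin n)) (c : Fin n → ZMod α) :
    flagStat (rPerm w) (rCol c) =
      α * ∑ i : Fin (n - 1), pairR w c (c ⟨0, hn⟩) (lo n i) (hi n i)
        + (c ⟨n - 1, by omega⟩ - c ⟨0, hn⟩).val := by
  rw [flag_eq hn]
  congr 1
  · congr 1
    rw [← Equiv.sum_comp (Fin.revPerm : Equiv.Perm (Fin (n - 1)))]
    apply Finset.sum_congr rfl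
    intro i _
    have hi' := i.isLt
    have a1 : (lo n (Fin.revPerm i)).rev = hi n i := by
      apply Fin.ext
      simp only [lo, hi, Fin.val_rev, Fin.revPerm_apply]
      omega
    have a2 : (hi n (Fin.revPerm i)).rev = lo n i := by
      apply Fin.ext
      simp only [lo, hi, Fin.val_rev, Fin.revPerm_apply]
      omega
    simp only [pairT, pairR, rCol, rPerm, Equiv.trans_apply, dif_pos hn, sub_left_inj]
    rw [Fin.revPerm_apply (lo n _), Fin.revPerm_apply (hi n _), a1, a2]
    simp only [eq_comm]
  · simp only [rCol, dif_pos hn]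
    congr 3

/-- Deleting a same-colored descent `w_{i}^{c_i}` (where `c_i = c_{i+1}` and `w_i > w_{i+1}`)
from a colored permutation with last color `0`, and relabeling order-isomorphically, reduces
exactly one of `flag(w)`, `flag(r(w))` by `α` and leaves the other unchanged; in total
`flag(w) + flag(r(w)) = flag(w') + flag(r(w')) + α`. -/
theorem flag_sum_reduction_by_deleting_descent (n α : ℕ) (hn : 2 ≤ n) (hα : 0 < α)
    (w : Equiv.Perm (Fin n)) (c : Fin n → ZMod α)
    (hlast : c ⟨n - 1, by omega⟩ = 0)
    (i₀ : Fin (n - 1))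
    (hdes : c (lo n i₀) = c (hi n i₀) ∧ w (hi n i₀) < w (lo n i₀))
    (w' : Equiv.Perm (Fin (n - 1))) (c' : Fin (n - 1) → ZMod α)
    (hc' : ∀ j, c' j = c (oldPos n i₀ j))
    (hw' : ∀ j k : Fin (n - 1), w' j < w' k ↔ w (oldPos n i₀ j) < w (oldPos n i₀ k)) :
    ((flagStat w c = flagStat w' c' + α ∧
        flagStat (rPerm w) (rCol c) = flagStat (rPerm w') (rCol c')) ∨
      (flagStat w c = flagStat w' c' ∧
        flagStat (rPerm w) (rCol c) = flagStat (rPerm w') (rCol c') + α)) ∧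
    flagStat w c + flagStat (rPerm w) (rCol c)
      = flagStat w' c' + flagStat (rPerm w') (rCol c') + α := by
  obtain ⟨m, rfl⟩ : ∃ m, n = m + 2 := ⟨n - 2, by omega⟩
  have hk := i₀.isLt
  have p1 : 0 < m + 2 - 1 := by omega
  have p2 : 0 < m + 2 := by omega
  have c0 : c' ⟨0, p1⟩ = c ⟨0, p2⟩ := by
    rw [hc']
    by_cases h : i₀.val = 0
    · have e1 : oldPos (m + 2) i₀ ⟨0, p1⟩ = hi (m + 2) i₀ := by
        apply Fin.ext
        simp [oldPos, hi, h]
      have e2 : (⟨0, p2⟩ : Fin (m + 2)) = lo (m + 2) i₀ := by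
        apply Fin.ext
        simp [lo, h]
      rw [e1, e2, hdes.1]
    · congr 1
      apply Fin.ext
      simp [oldPos, Nat.pos_of_ne_zero h]
  have cl : c' ⟨m + 2 - 1 - 1, by omega⟩ = c ⟨m + 2 - 1, by omega⟩ := by
    rw [hc']
    congr 1
    apply Fin.ext
    simp only [oldPos]
    rw [if_neg (by omega)]
    simp
  have hT : ∀ p q, pairT w' c' p q = pairT w c (oldPos (m + 2) i₀ p) (oldPos (m + 2) i₀ q) := by
    intro p q
    simp only [pairT, hc', hw']
  have hR : ∀ u p q, pairR w' c' u p q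
      = pairR w c u (oldPos (m + 2) i₀ p) (oldPos (m + 2) i₀ q) := by
    intro u p q
    simp only [pairR, hc', hw']
  rw [flag_eq p2, flag_eq p1, flag_r_eq p2, flag_r_eq p1, c0, cl]
  simp only [hT, hR]
  have s1 := sum_del m (pairT w c) i₀
  have s2 := sum_del m (pairR w c (c ⟨0, p2⟩)) i₀
  generalize (∑ i : Fin (m + 2 - 1), pairT w c (lo (m + 2) i) (hi (m + 2) i)) = S at *
  generalize (∑ i : Fin (m + 2 - 1), pairR w c (c ⟨0, p2⟩) (lo (m + 2) i) (hi (m + 2) i)) = R at *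
  generalize (∑ j : Fin (m + 2 - 1 - 1), pairT w c (oldPos (m + 2) i₀ (lo (m + 2 - 1) j))
        (oldPos (m + 2) i₀ (hi (m + 2 - 1) j))) = S' at *
  generalize (∑ j : Fin (m + 2 - 1 - 1), pairR w c (c ⟨0, p2⟩)
        (oldPos (m + 2) i₀ (lo (m + 2 - 1) j))
        (oldPos (m + 2) i₀ (hi (m + 2 - 1) j))) = R' at *
  have main : (S = S' + 1 ∧ R = R') ∨ (S = S' ∧ R = R' + 1) := by
    obtain ⟨d1, d2⟩ := hdes
    have t1 : pairT w c (lo (m + 2) i₀) (hi (m + 2) i₀) = 1 := by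
      simp [pairT, d1, d2]
    have t2 : pairR w c (c ⟨0, p2⟩) (lo (m + 2) i₀) (hi (m + 2) i₀) = 0 := by
      simp [pairR, d1, d2.le]
    rw [t1] at s1
    rw [t2] at s2
    by_cases h : i₀.val = 0
    · simp only [dif_pos h] at s1 s2
      omega
    · simp only [dif_neg h] at s1 s2
      have n1 : w ⟨i₀.val - 1, by omega⟩ ≠ w (lo (m + 2) i₀) := by
        intro e
        have := congrArg Fin.val (w.injective e)
        simp only [lo] at this
        omega
      have n2 : w ⟨i₀.val - 1, by omega⟩ ≠ w (hi (m + 2) i₀) := by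
        intro e
        have := congrArg Fin.val (w.injective e)
        simp only [hi] at this
        omega
      simp only [pairT, pairR, d1] at s1 s2
      by_cases hc : c ⟨i₀.val - 1, by omega⟩ = c (hi (m + 2) i₀)
      · simp only [hc, true_and, lt_irrefl, if_false] at s1 s2
        rcases lt_or_gt_of_ne n1 with g1 | g1 <;> rcases lt_or_gt_of_ne n2 with g2 | g2 <;>
          simp only [g1, g2, not_lt_of_gt g1, not_lt_of_gt g2, if_true, if_false] at s1 s2 <;>
          first
          | omega
          | exact absurd (d2.trans g1) (not_lt_of_gt g2)
      · simp only [hc, false_and, if_false] at s1 s2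
        omega
  rcases main with ⟨rfl, rfl⟩ | ⟨rfl, rfl⟩
  · refine ⟨Or.inl ⟨by ring, rfl⟩, by ring⟩
  · refine ⟨Or.inr ⟨rfl, by ring⟩, by ring⟩
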